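/- Let X be a measurable space and for each n ≥ 0 let V_n be a vector space over ℚ of countable dimension; set V_{−1} = ℚ. Suppose that for each n ≥ 0 we are given a measurable field of ℚ-linear maps x ↦ ∂_{n,x} : V_n → V_{n−1} such that for every x ∈ X the augmented complex 0 ← ℚ ← V_0 ← V_1 ← ⋯ (with maps ∂_{n,x}) is exact, i.e., ∂_{0,x} is surjective, ∂_{n,x} ∘ ∂_{n+1,x} = 0, and ker ∂_{n,x} = range ∂_{n+1,x} for all n ≥ 0. Then there exist measurable fields of ℚ-linear maps x ↦ h_{n,x} : V_n → V_{n+1}, for n ≥ −1, such that for every x ∈ X: ∂_{0,x} ∘ h_{−1,x} = id_ℚ, and id_{V_n} = h_{n−1,x} ∘ ∂_{n,x} + ∂_{n+1,x} ∘ h_{n,x} for all n ≥ 0. -/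

import Mathlib

open Cardinal

theorem countable_of_rank_le_aleph0 {K V : Type*} [Field K] [Countable K] [AddCommGroup V]
    [Module K V] (hV : Module.rank K V ≤ ℵ₀) : Countable V := by
  let b := Module.Free.chooseBasis K V
  have : Countable (Module.Free.ChooseBasisIndex K V) := by
    rwa [← Cardinal.mk_le_aleph0_iff, ← Module.Free.rank_eq_card_chooseBasisIndex]
  exact b.repr.toEquiv.countable_iff.mpr inferInstance

section MeasurableFields

variable {X K U V W : Type*} [MeasurableSpace X] [Field K]
  [AddCommGroup U] [Module K U] [MeasurableSpace U] [DiscreteMeasurableSpace U]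
  [AddCommGroup V] [Module K V]
  [AddCommGroup W] [Module K W] [MeasurableSpace W] [DiscreteMeasurableSpace W]

/-- Evaluating a measurable field of functions at a measurable section with countably many values
gives a measurable section. -/
theorem measurable_eval_field {Y Z : Type*} [Countable Y] [MeasurableSpace Y]
    [DiscreteMeasurableSpace Y] [MeasurableSpace Z] {f : X → Y → Z}
    (hf : ∀ y, Measurable fun x => f x y) {s : X → Y} (hs : Measurable s) :
    Measurable fun x => f x (s x) :=
  (measurable_from_prod_countable_left (f := fun p : X × Y => f p.1 p.2) hf).comp
    (measurable_id.prodMk hs)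

/-- A measurable field of linear maps lifts along a measurable field of linear maps on a countable
space as soon as it does so pointwise. -/
theorem exists_measurable_lift [Countable U] [Countable W] {D : X → W →ₗ[K] U} {g : X → V →ₗ[K] U}
    (hD : ∀ w, Measurable fun x => D x w) (hg : ∀ v, Measurable fun x => g x v)
    (hrange : ∀ x v, g x v ∈ LinearMap.range (D x)) :
    ∃ h : X → V →ₗ[K] W, (∀ v, Measurable fun x => h x v) ∧ ∀ x, D x ∘ₗ h x = g x := by
  classical
  obtain ⟨e, he⟩ := exists_surjective_nat W
  have hex (v : V) (x : X) : ∃ k, D x (e k) = g x v := by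
    obtain ⟨w, hw⟩ := hrange x v
    obtain ⟨k, rfl⟩ := he w
    exact ⟨k, hw⟩
  have hlift (v : V) : Measurable fun x => e (Nat.find (hex v x)) :=
    Measurable.comp (measurable_from_nat (f := e))
      (measurable_find (hex v) fun k => measurableSet_eq_fun (hD (e k)) (hg v))
  let b := Module.Free.chooseBasis K V
  refine ⟨fun x => b.constr K fun i => e (Nat.find (hex (b i) x)), fun v => ?_, fun x => ?_⟩
  · simp only [Module.Basis.constr_apply, Finsupp.sum]
    refine Finset.measurable_fun_sum _ fun i _ => ?_
    exact (Measurable.of_discrete (f := fun w : W => b.repr v i • w)).comp (hlift (b i))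
  · refine b.ext fun i => ?_
    simpa using Nat.find_spec (hex (b i) x)

end MeasurableFields

/-- **Measurable contracting homotopies (from the proof of Proposition 9).**
Let `X` be a measurable space and, for `n ≥ 0`, let `V n` be a `ℚ`-vector
space of countable dimension with the discrete σ-algebra (and `V_{-1} = ℚ`).
Given measurable fields of boundary maps `∂_{0,x} : V 0 → ℚ` and
`∂_{n+1,x} : V (n+1) → V n` such that for every `x` the augmented complex
`0 ← ℚ ← V 0 ← V 1 ← ⋯` is exact, there exist measurable fields of linear
maps `h_{-1,x} : ℚ → V 0` and `h_{n,x} : V n → V (n+1)` such that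
`∂_{0,x} ∘ h_{-1,x} = id` and
`id = h_{n-1,x} ∘ ∂_{n,x} + ∂_{n+1,x} ∘ h_{n,x}` for all `n ≥ 0`. -/
theorem stmt_4 {X : Type*} [MeasurableSpace X]
    (V : ℕ → Type*) [∀ n, AddCommGroup (V n)] [∀ n, Module ℚ (V n)]
    [∀ n, MeasurableSpace (V n)]
    (hdisc : ∀ n, ∀ s : Set (V n), MeasurableSet s)
    (hdim : ∀ n, Module.rank ℚ (V n) ≤ ℵ₀)
    (d0 : X → (V 0 →ₗ[ℚ] ℚ))
    (d : X → ∀ n, (V (n + 1) →ₗ[ℚ] V n))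
    (hd0meas : ∀ v : V 0, Measurable fun x => d0 x v)
    (hdmeas : ∀ n, ∀ v : V (n + 1), Measurable fun x => d x n v)
    (hsurj : ∀ x, Function.Surjective (d0 x))
    (hcomp0 : ∀ x, (d0 x) ∘ₗ (d x 0) = 0)
    (hcomp : ∀ x n, (d x n) ∘ₗ (d x (n + 1)) = 0)
    (hexact0 : ∀ x, LinearMap.ker (d0 x) = LinearMap.range (d x 0))
    (hexact : ∀ x n, LinearMap.ker (d x n) = LinearMap.range (d x (n + 1))) :
    ∃ (hneg : X → (ℚ →ₗ[ℚ] V 0)) (h : X → ∀ n, (V n →ₗ[ℚ] V (n + 1))),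
      (∀ c : ℚ, Measurable fun x => hneg x c) ∧
      (∀ n, ∀ v : V n, Measurable fun x => h x n v) ∧
      (∀ x, (d0 x) ∘ₗ (hneg x) = LinearMap.id) ∧
      (∀ x, (hneg x) ∘ₗ (d0 x) + (d x 0) ∘ₗ (h x 0) = LinearMap.id) ∧
      (∀ x n, (h x n) ∘ₗ (d x n) + (d x (n + 1)) ∘ₗ (h x (n + 1))
        = LinearMap.id) := by
  have hctb (n : ℕ) : Countable (V n) := countable_of_rank_le_aleph0 (hdim n)
  have hdisc' (n : ℕ) : DiscreteMeasurableSpace (V n) := ⟨hdisc n⟩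
  have hsub (n : ℕ) (v : V n) {s : X → V n} (hs : Measurable s) :
      Measurable fun x => v - s x :=
    (Measurable.of_discrete (f := fun w : V n => v - w)).comp hs
  obtain ⟨hneg, hneg_meas, hneg_eq⟩ := exists_measurable_lift (V := ℚ) hd0meas
    (g := fun _ => LinearMap.id) (fun _ => measurable_const) (fun x c => hsurj x c)
  have hneg_apply (x : X) (c : ℚ) : d0 x (hneg x c) = c := LinearMap.congr_fun (hneg_eq x) c
  obtain ⟨h0, h0_meas, h0_eq⟩ := exists_measurable_lift (hdmeas 0)
    (g := fun x => LinearMap.id - hneg x ∘ₗ d0 x)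
    (fun v => hsub 0 v (measurable_eval_field hneg_meas (hd0meas v)))
    (fun x v => by simp [← hexact0, hneg_apply])
  let IsSection (n : ℕ) (f : X → V n →ₗ[ℚ] V (n + 1)) : Prop :=
    (∀ v, Measurable fun x => f x v) ∧ ∀ x v, d x n (f x (d x n v)) = d x n v
  have h0_section : IsSection 0 h0 := by
    refine ⟨h0_meas, fun x v => ?_⟩
    have hd : d0 x (d x 0 v) = 0 := LinearMap.congr_fun (hcomp0 x) v
    simpa [hd] using LinearMap.congr_fun (h0_eq x) (d x 0 v)
  have step (n : ℕ) (f : {f : X → V n →ₗ[ℚ] V (n + 1) // IsSection n f}) :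
      ∃ f' : {f' : X → V (n + 1) →ₗ[ℚ] V (n + 2) // IsSection (n + 1) f'},
        ∀ x, f.1 x ∘ₗ d x n + d x (n + 1) ∘ₗ f'.1 x = LinearMap.id := by
    obtain ⟨f, f_meas, f_eq⟩ := f
    obtain ⟨f', f'_meas, f'_eq⟩ := exists_measurable_lift (hdmeas (n + 1))
      (g := fun x => LinearMap.id - f x ∘ₗ d x n)
      (fun v => hsub (n + 1) v (measurable_eval_field f_meas (hdmeas n v)))
      (fun x v => by simp [← hexact, f_eq])
    refine ⟨⟨f', f'_meas, fun x v => ?_⟩, fun x => by simp [f'_eq]⟩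
    have hd : d x n (d x (n + 1) v) = 0 := LinearMap.congr_fun (hcomp x n) v
    simpa [hd] using LinearMap.congr_fun (f'_eq x) (d x (n + 1) v)
  choose next hnext using step
  let h (n : ℕ) : {f : X → V n →ₗ[ℚ] V (n + 1) // IsSection n f} :=
    Nat.rec ⟨h0, h0_section⟩ next n
  exact ⟨hneg, fun x n => (h n).1 x, hneg_meas, fun n => (h n).2.1, hneg_eq,
    fun x => by simp [h, h0_eq], fun x n => hnext n (h n) x⟩
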